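/- (Expected position for a driven harmonic oscillator) Fix a > 0, b ∈ ℝ, and σ > 0. Let Ψ : ℝ × ℝ → ℂ solve the one-dimensional Schrödinger equation i ∂Ψ/∂t (t,x) = −(1/2) ∂²Ψ/∂x² (t,x) + ((1/2) a x² + b x) Ψ(t,x) with initial condition Ψ(0,x) = (1/(2πσ²))^{1/4} e^{−x²/(4σ²)}; assume Ψ is continuously differentiable in t, that for each t the function x ↦ Ψ(t,x) is smooth and, together with its x-derivatives up to second order, decays rapidly (faster than any inverse polynomial) in x, locally uniformly in t. Then for every t ≥ 0, the expectation of the position observable satisfies ∫_ℝ x |Ψ(t,x)|² dx = (b/a)(cos(√a · t) − 1). -/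

import Mathlib

open MeasureTheory Filter Topology

/-- A family `w t` of continuous functions of `x`, decaying faster than any inverse polynomial,
locally uniformly in `t`. -/
structure RapidDecay (w : ℝ → ℝ → ℝ) : Prop where
  continuous : ∀ t, Continuous (w t)
  bound : ∀ k : ℕ, ∀ T : ℝ, 0 < T → ∃ C : ℝ, ∀ t x : ℝ, |t| ≤ T → |w t x| * |x| ^ k ≤ C

namespace RapidDecay

variable {w z : ℝ → ℝ → ℝ}

theorem add (hw : RapidDecay w) (hz : RapidDecay z) :
    RapidDecay fun t x => w t x + z t x where
  continuous t := (hw.continuous t).add (hz.continuous t)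
  bound k T hT := by
    obtain ⟨C, hC⟩ := hw.bound k T hT
    obtain ⟨D, hD⟩ := hz.bound k T hT
    refine ⟨C + D, fun t x ht => ?_⟩
    calc |w t x + z t x| * |x| ^ k ≤ (|w t x| + |z t x|) * |x| ^ k := by
          gcongr; exact abs_add_le _ _
      _ ≤ C + D := by rw [add_mul]; exact add_le_add (hC t x ht) (hD t x ht)

theorem const_mul (c : ℝ) (hw : RapidDecay w) : RapidDecay fun t x => c * w t x where
  continuous t := (hw.continuous t).const_mul c
  bound k T hT := by
    obtain ⟨C, hC⟩ := hw.bound k T hT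
    refine ⟨|c| * C, fun t x ht => ?_⟩
    rw [abs_mul, mul_assoc]
    exact mul_le_mul_of_nonneg_left (hC t x ht) (abs_nonneg c)

theorem sub (hw : RapidDecay w) (hz : RapidDecay z) :
    RapidDecay fun t x => w t x - z t x := by
  simpa [sub_eq_add_neg] using hw.add (hz.const_mul (-1))

theorem id_mul (hw : RapidDecay w) : RapidDecay fun t x => x * w t x where
  continuous t := continuous_id.mul (hw.continuous t)
  bound k T hT := by
    obtain ⟨C, hC⟩ := hw.bound (k + 1) T hT
    refine ⟨C, fun t x ht => ?_⟩
    have := hC t x ht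
    rw [abs_mul]
    rwa [pow_succ, ← mul_assoc, mul_right_comm, mul_comm _ |x|] at this

theorem exists_abs_le (hw : RapidDecay w) {T : ℝ} (hT : 0 < T) :
    ∃ C : ℝ, 0 ≤ C ∧ ∀ t x : ℝ, |t| ≤ T → |w t x| ≤ C := by
  obtain ⟨C, hC⟩ := hw.bound 0 T hT
  simp only [pow_zero, mul_one] at hC
  exact ⟨C, (abs_nonneg _).trans (hC 0 0 (by simpa using hT.le)), hC⟩

theorem mul (hw : RapidDecay w) (hz : RapidDecay z) :
    RapidDecay fun t x => w t x * z t x where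
  continuous t := (hw.continuous t).mul (hz.continuous t)
  bound k T hT := by
    obtain ⟨C, hC0, hC⟩ := hw.exists_abs_le hT
    obtain ⟨D, hD⟩ := hz.bound k T hT
    refine ⟨C * D, fun t x ht => ?_⟩
    rw [abs_mul, mul_assoc]
    exact mul_le_mul (hC t x ht) (hD t x ht) (by positivity) hC0

theorem comp_time (hw : RapidDecay w) (s : ℝ) : RapidDecay fun _ x => w s x where
  continuous _ := hw.continuous s
  bound k T hT := by
    obtain ⟨C, hC⟩ := hw.bound k (|s| + 1) (by positivity)
    exact ⟨C, fun t x _ => hC s x (by linarith)⟩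

theorem exists_abs_le_inv (hw : RapidDecay w) {T : ℝ} (hT : 0 < T) :
    ∃ C : ℝ, 0 ≤ C ∧ ∀ t x : ℝ, |t| ≤ T → |w t x| ≤ C * (1 + x ^ 2)⁻¹ := by
  obtain ⟨C, hC0, hC⟩ := (hw.add hw.id_mul.id_mul).exists_abs_le hT
  refine ⟨C, hC0, fun t x ht => ?_⟩
  have hx : 0 < 1 + x ^ 2 := by positivity
  rw [← div_eq_mul_inv, le_div_iff₀ hx]
  have := hC t x ht
  rwa [show w t x + x * (x * w t x) = w t x * (1 + x ^ 2) by ring, abs_mul, abs_of_pos hx] at this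

theorem integrable (hw : RapidDecay w) (t : ℝ) : Integrable (w t) := by
  obtain ⟨C, -, hC⟩ := hw.exists_abs_le_inv (T := |t| + 1) (by positivity)
  exact (integrable_inv_one_add_sq.const_mul C).mono' (hw.continuous t).aestronglyMeasurable
    (.of_forall fun x => hC t x (by linarith))

theorem integral_eq_zero_of_hasDerivAt (hw : RapidDecay w) (hz : RapidDecay z) {t : ℝ}
    (h : ∀ x, HasDerivAt (w t) (z t x) x) : ∫ x, z t x = 0 :=
  integral_eq_zero_of_hasDerivAt_of_integrable h (hz.integrable t) (hw.integrable t)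

/-- Pointwise continuity in time passes to the space derivative, as soon as the second space
derivative is locally bounded. -/
theorem continuous_deriv_time {w₁ w₂ : ℝ → ℝ → ℝ} (hw₂ : RapidDecay w₂)
    (h₁ : ∀ t x, HasDerivAt (w t) (w₁ t x) x) (h₂ : ∀ t x, HasDerivAt (w₁ t) (w₂ t x) x)
    (hc : ∀ x, Continuous fun t => w t x) (x : ℝ) : Continuous fun t => w₁ t x := by
  rw [continuous_iff_continuousAt]
  intro t
  obtain ⟨C, hC0, hC⟩ := hw₂.exists_abs_le (T := |t| + 1) (by positivity)
  refine continuousAt_of_locally_uniform_approx_of_continuousAt fun U hU => ?_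
  obtain ⟨ε, hε, hεU⟩ := Metric.mem_uniformity_dist.1 hU
  set s := ε / (C + 1) with hs
  have hs0 : 0 < s := by positivity
  have hCs : C * s < ε := by
    rw [hs, mul_div_assoc', div_lt_iff₀ (by positivity)]
    nlinarith
  refine ⟨{τ | |τ| < |t| + 1}, (continuous_abs.isOpen_preimage _ isOpen_Iio).mem_nhds (by simp),
    fun τ => (w τ (x + s) - w τ x) / s,
    (((hc (x + s)).sub (hc x)).div_const s).continuousAt, fun τ hτ => hεU ?_⟩
  obtain ⟨ξ, hξ, hξs⟩ := exists_hasDerivAt_eq_slope (w τ) (w₁ τ) (by linarith : x < x + s)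
    (fun y _ => (h₁ τ y).continuousAt.continuousWithinAt) (fun y _ => h₁ τ y)
  rw [add_sub_cancel_left] at hξs
  rw [dist_comm, Real.dist_eq]
  beta_reduce
  rw [← hξs]
  have := convex_univ.norm_image_sub_le_of_norm_hasDerivWithin_le (f := w₁ τ) (x := x) (y := ξ)
    (fun y _ => (h₂ τ y).hasDerivWithinAt) (fun y _ => hC τ y (le_of_lt hτ)) trivial trivial
  simp only [Real.norm_eq_abs] at this
  refine (this.trans ?_).trans_lt hCs
  rw [abs_of_pos (sub_pos.2 hξ.1)]
  gcongr
  linarith [hξ.2]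

theorem tendsto_integral_slope_mul {w' g : ℝ → ℝ → ℝ} (hw : RapidDecay w) (hw' : RapidDecay w')
    (hg : RapidDecay g) (h : ∀ t x, HasDerivAt (fun τ => w τ x) (w' t x) t)
    (hc : ∀ x, Continuous fun t => g t x) (t : ℝ) :
    Tendsto (fun s => ∫ x, slope (fun τ => w τ x) t s * g s x) (𝓝[≠] t)
      (𝓝 (∫ x, w' t x * g t x)) := by
  have hT : 0 < |t| + 1 := by positivity
  obtain ⟨C, hC0, hC⟩ := hw'.exists_abs_le_inv hT
  obtain ⟨D, hD0, hD⟩ := hg.exists_abs_le hT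
  have hnear : ∀ᶠ s in 𝓝[≠] t, |s| ≤ |t| + 1 :=
    mem_nhdsWithin_of_mem_nhds (mem_of_superset
      ((continuous_abs.isOpen_preimage _ isOpen_Iio).mem_nhds
        (by simp : t ∈ abs ⁻¹' Set.Iio (|t| + 1))) fun s (hs : |s| < |t| + 1) => hs.le)
  refine tendsto_integral_filter_of_dominated_convergence
    (fun x => C * (1 + x ^ 2)⁻¹ * D) (.of_forall fun s => ?_) ?_
    ((integrable_inv_one_add_sq.const_mul C).mul_const D) (.of_forall fun x => ?_)
  · simp only [slope_def_field]
    exact ((((hw.continuous s).sub (hw.continuous t)).div_const _).mul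
      (hg.continuous s)).aestronglyMeasurable
  · filter_upwards [hnear, self_mem_nhdsWithin] with s hs hne
    refine .of_forall fun x => ?_
    rw [norm_mul]
    refine mul_le_mul ?_ (hD s x hs) (norm_nonneg _) (by positivity)
    have := (convex_Icc (-(|t| + 1)) (|t| + 1)).norm_image_sub_le_of_norm_hasDerivWithin_le
      (f := fun τ => w τ x) (x := t) (y := s) (fun y _ => (h y x).hasDerivWithinAt)
      (fun y hy => hC y x (abs_le.2 hy)) (abs_le.1 (by linarith)) (abs_le.1 hs)
    rw [slope_def_field, norm_div]
    exact (div_le_iff₀ (norm_pos_iff.2 (sub_ne_zero.2 hne))).2 this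
  · exact (hasDerivAt_iff_tendsto_slope.1 (h t x)).mul
      ((hc x).continuousAt.tendsto.mono_left nhdsWithin_le_nhds)

theorem hasDerivAt_integral {w' : ℝ → ℝ → ℝ} (hw : RapidDecay w)
    (hw' : RapidDecay w') (h : ∀ t x, HasDerivAt (fun τ => w τ x) (w' t x) t) (t : ℝ) :
    HasDerivAt (fun t => ∫ x, w t x) (∫ x, w' t x) t := by
  have hT : 0 < |t| + 2 := by positivity
  obtain ⟨C, hC0, hC⟩ := hw'.exists_abs_le_inv hT
  refine (hasDerivAt_integral_of_dominated_loc_of_deriv_le (Metric.ball_mem_nhds t one_pos)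
    (.of_forall fun s => (hw.continuous s).aestronglyMeasurable) (hw.integrable t)
    (hw'.continuous t).aestronglyMeasurable (bound := fun x => C * (1 + x ^ 2)⁻¹)
    (.of_forall fun x s hs => hC s x ?_) (integrable_inv_one_add_sq.const_mul C)
    (.of_forall fun x s _ => h s x)).2
  rw [Metric.mem_ball, Real.dist_eq] at hs
  linarith [abs_sub_abs_le_abs_sub s t]

end RapidDecay

/-- Real form of the one-dimensional Schrödinger equation for `u + i v` in the potential
`(1/2) a x² + b x`; `u₁, v₁` and `u₂, v₂` are the first and second space derivatives. -/
structure IsOscillatorSolution (a b : ℝ) (u v u₁ v₁ u₂ v₂ : ℝ → ℝ → ℝ) : Prop where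
  decay_re : RapidDecay u
  decay_im : RapidDecay v
  decay_re₁ : RapidDecay u₁
  decay_im₁ : RapidDecay v₁
  decay_re₂ : RapidDecay u₂
  decay_im₂ : RapidDecay v₂
  deriv_re : ∀ t x, HasDerivAt (u t) (u₁ t x) x
  deriv_im : ∀ t x, HasDerivAt (v t) (v₁ t x) x
  deriv_re₁ : ∀ t x, HasDerivAt (u₁ t) (u₂ t x) x
  deriv_im₁ : ∀ t x, HasDerivAt (v₁ t) (v₂ t x) x
  deriv_time_re : ∀ t x, HasDerivAt (fun τ => u τ x)
    (-(1 / 2) * v₂ t x + (1 / 2 * a * (x * (x * v t x)) + b * (x * v t x))) t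
  deriv_time_im : ∀ t x, HasDerivAt (fun τ => v τ x)
    (1 / 2 * u₂ t x - (1 / 2 * a * (x * (x * u t x)) + b * (x * u t x))) t

namespace IsOscillatorSolution

variable {a b : ℝ} {u v u₁ v₁ u₂ v₂ : ℝ → ℝ → ℝ}

theorem decay_time_re (h : IsOscillatorSolution a b u v u₁ v₁ u₂ v₂) : RapidDecay fun t x =>
    -(1 / 2) * v₂ t x + (1 / 2 * a * (x * (x * v t x)) + b * (x * v t x)) :=
  (h.decay_im₂.const_mul _).add
    ((h.decay_im.id_mul.id_mul.const_mul _).add (h.decay_im.id_mul.const_mul _))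

theorem decay_time_im (h : IsOscillatorSolution a b u v u₁ v₁ u₂ v₂) : RapidDecay fun t x =>
    1 / 2 * u₂ t x - (1 / 2 * a * (x * (x * u t x)) + b * (x * u t x)) :=
  (h.decay_re₂.const_mul _).sub
    ((h.decay_re.id_mul.id_mul.const_mul _).add (h.decay_re.id_mul.const_mul _))

theorem decay_density (h : IsOscillatorSolution a b u v u₁ v₁ u₂ v₂) :
    RapidDecay fun t x => u t x * u t x + v t x * v t x :=
  (h.decay_re.mul h.decay_re).add (h.decay_im.mul h.decay_im)

theorem decay_current (h : IsOscillatorSolution a b u v u₁ v₁ u₂ v₂) :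
    RapidDecay fun t x => u t x * v₁ t x - v t x * u₁ t x :=
  (h.decay_re.mul h.decay_im₁).sub (h.decay_im.mul h.decay_re₁)

theorem decay_deriv_current (h : IsOscillatorSolution a b u v u₁ v₁ u₂ v₂) :
    RapidDecay fun t x => -1 * (u t x * v₂ t x - v t x * u₂ t x) :=
  ((h.decay_re.mul h.decay_im₂).sub (h.decay_im.mul h.decay_re₂)).const_mul _

theorem hasDerivAt_current (h : IsOscillatorSolution a b u v u₁ v₁ u₂ v₂) (t x : ℝ) :
    HasDerivAt (fun x => u t x * v₁ t x - v t x * u₁ t x) (u t x * v₂ t x - v t x * u₂ t x) x := by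
  refine (((h.deriv_re t x).mul (h.deriv_im₁ t x)).sub
    ((h.deriv_im t x).mul (h.deriv_re₁ t x))).congr_deriv ?_
  ring

theorem hasDerivAt_density (h : IsOscillatorSolution a b u v u₁ v₁ u₂ v₂) (t x : ℝ) :
    HasDerivAt (fun τ => u τ x * u τ x + v τ x * v τ x)
      (-1 * (u t x * v₂ t x - v t x * u₂ t x)) t := by
  refine (((h.deriv_time_re t x).mul (h.deriv_time_re t x)).add
    ((h.deriv_time_im t x).mul (h.deriv_time_im t x))).congr_deriv ?_
  ring

theorem hasDerivAt_mass (h : IsOscillatorSolution a b u v u₁ v₁ u₂ v₂) (t : ℝ) :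
    HasDerivAt (fun t => ∫ x, u t x * u t x + v t x * v t x) 0 t := by
  refine (h.decay_density.hasDerivAt_integral h.decay_deriv_current
    h.hasDerivAt_density t).congr_deriv ?_
  exact (h.decay_current.const_mul (-1)).integral_eq_zero_of_hasDerivAt h.decay_deriv_current
    fun x => (h.hasDerivAt_current t x).const_mul (-1)

theorem hasDerivAt_position (h : IsOscillatorSolution a b u v u₁ v₁ u₂ v₂) (t : ℝ) :
    HasDerivAt (fun t => ∫ x, x * (u t x * u t x + v t x * v t x))
      (∫ x, u t x * v₁ t x - v t x * u₁ t x) t := by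
  refine (h.decay_density.id_mul.hasDerivAt_integral h.decay_deriv_current.id_mul
    (fun t x => (h.hasDerivAt_density t x).const_mul x) t).congr_deriv ?_
  rw [← sub_eq_zero, ← integral_sub (h.decay_deriv_current.id_mul.integrable t)
    (h.decay_current.integrable t)]
  refine (h.decay_current.id_mul.const_mul (-1)).integral_eq_zero_of_hasDerivAt
    (h.decay_deriv_current.id_mul.sub h.decay_current) fun x => ?_
  refine (((hasDerivAt_id x).mul (h.hasDerivAt_current t x)).const_mul (-1)).congr_deriv ?_
  simp only [id]
  ring

theorem integral_current_sub (h : IsOscillatorSolution a b u v u₁ v₁ u₂ v₂) (s t : ℝ) :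
    (∫ x, u s x * v₁ s x - v s x * u₁ s x) - ∫ x, u t x * v₁ t x - v t x * u₁ t x =
      (∫ x, (u s x - u t x) * (v₁ s x + v₁ t x)) -
        ∫ x, (v s x - v t x) * (u₁ s x + u₁ t x) := by
  have hu := (h.decay_re.sub (h.decay_re.comp_time t)).mul
    (h.decay_im₁.add (h.decay_im₁.comp_time t))
  have hv := (h.decay_im.sub (h.decay_im.comp_time t)).mul
    (h.decay_re₁.add (h.decay_re₁.comp_time t))
  have hcross := ((h.decay_re.comp_time t).mul h.decay_im).sub
    ((h.decay_im.comp_time t).mul h.decay_re)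
  have hcross₁ := (h.decay_current.sub (h.decay_current.comp_time t)).sub (hu.sub hv)
  have key := hcross.integral_eq_zero_of_hasDerivAt (t := s) hcross₁ fun x => by
    refine (((h.deriv_re t x).mul (h.deriv_im s x)).sub
      ((h.deriv_im t x).mul (h.deriv_re s x))).congr_deriv ?_
    ring
  rw [integral_sub ((h.decay_current.sub (h.decay_current.comp_time t)).integrable s)
    ((hu.sub hv).integrable s), integral_sub (h.decay_current.integrable s)
    ((h.decay_current.comp_time t).integrable s), integral_sub (hu.integrable s)
    (hv.integrable s)] at key
  exact sub_eq_zero.1 key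

theorem hasDerivAt_momentum (h : IsOscillatorSolution a b u v u₁ v₁ u₂ v₂) (t : ℝ) :
    HasDerivAt (fun t => ∫ x, u t x * v₁ t x - v t x * u₁ t x)
      (-a * (∫ x, x * (u t x * u t x + v t x * v t x)) -
        b * ∫ x, u t x * u t x + v t x * v t x) t := by
  rw [hasDerivAt_iff_tendsto_slope]
  have hcu := RapidDecay.continuous_deriv_time h.decay_re₂ h.deriv_re h.deriv_re₁
    fun x => continuous_iff_continuousAt.2 fun t => (h.deriv_time_re t x).continuousAt
  have hcv := RapidDecay.continuous_deriv_time h.decay_im₂ h.deriv_im h.deriv_im₁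
    fun x => continuous_iff_continuousAt.2 fun t => (h.deriv_time_im t x).continuousAt
  have hlim := (h.decay_re.tendsto_integral_slope_mul h.decay_time_re
    (h.decay_im₁.add (h.decay_im₁.comp_time t)) h.deriv_time_re
    (fun x => (hcv x).add continuous_const) t).sub
    (h.decay_im.tendsto_integral_slope_mul h.decay_time_im
    (h.decay_re₁.add (h.decay_re₁.comp_time t)) h.deriv_time_im
    (fun x => (hcu x).add continuous_const) t)
  convert hlim using 1
  · funext s
    rw [slope_def_field, h.integral_current_sub s t, sub_div, ← integral_div, ← integral_div]
    simp only [slope_def_field, div_mul_eq_mul_div]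
  · congr 1
    have hu := h.decay_time_re.mul (h.decay_im₁.add (h.decay_im₁.comp_time t))
    have hv := h.decay_time_im.mul (h.decay_re₁.add (h.decay_re₁.comp_time t))
    have hX := h.decay_density.id_mul.const_mul (-a)
    have hN := h.decay_density.const_mul b
    rw [← integral_const_mul, ← integral_const_mul,
      ← integral_sub (hX.integrable t) (hN.integrable t),
      ← integral_sub (hu.integrable t) (hv.integrable t), eq_comm, ← sub_eq_zero,
      ← integral_sub ((hu.sub hv).integrable t) ((hX.sub hN).integrable t)]
    have hE := (((h.decay_re₁.mul h.decay_re₁).add (h.decay_im₁.mul h.decay_im₁)).const_mul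
      (-(1 / 2))).add ((h.decay_density.id_mul.id_mul.const_mul (1 / 2 * a)).add
        (h.decay_density.id_mul.const_mul b))
    refine hE.integral_eq_zero_of_hasDerivAt ((hu.sub hv).sub (hX.sub hN)) fun x => ?_
    have hx := hasDerivAt_id x
    have hd := ((h.deriv_re t x).mul (h.deriv_re t x)).add ((h.deriv_im t x).mul (h.deriv_im t x))
    refine (((((h.deriv_re₁ t x).mul (h.deriv_re₁ t x)).add
      ((h.deriv_im₁ t x).mul (h.deriv_im₁ t x))).const_mul (-(1 / 2))).add
      (((hx.mul (hx.mul hd)).const_mul (1 / 2 * a)).add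
        ((hx.mul hd).const_mul b))).congr_deriv ?_
    simp only [id, Pi.mul_apply, Pi.add_apply]
    ring

end IsOscillatorSolution

/-- The initial value problem `X' = P`, `P' = -a X - b`, `X 0 = P 0 = 0`. -/
theorem driven_oscillator_ode {a b : ℝ} (ha : 0 < a) {X P : ℝ → ℝ}
    (hX : ∀ t, HasDerivAt X (P t) t) (hP : ∀ t, HasDerivAt P (-a * X t - b) t)
    (hX0 : X 0 = 0) (hP0 : P 0 = 0) (t : ℝ) :
    X t = b / a * (Real.cos (Real.sqrt a * t) - 1) := by
  set r := Real.sqrt a with hr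
  have hr2 : r * r = a := Real.mul_self_sqrt ha.le
  have hlin (t : ℝ) : HasDerivAt (fun t => r * t) r t := by
    simpa using (hasDerivAt_id t).const_mul r
  have hY (t : ℝ) : HasDerivAt (fun t => X t - b / a * (Real.cos (r * t) - 1))
      (P t + b / a * r * Real.sin (r * t)) t := by
    refine ((hX t).sub (((hlin t).cos.sub_const 1).const_mul (b / a))).congr_deriv ?_
    ring
  have hZ (t : ℝ) : HasDerivAt (fun t => P t + b / a * r * Real.sin (r * t))
      (-a * (X t - b / a * (Real.cos (r * t) - 1))) t := by
    refine ((hP t).add ((hlin t).sin.const_mul (b / a * r))).congr_deriv ?_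
    have hba : b / a * a = b := div_mul_cancel₀ b ha.ne'
    linear_combination (b / a * Real.cos (r * t)) * hr2 + hba
  have hE (t : ℝ) : HasDerivAt (fun t => a * (X t - b / a * (Real.cos (r * t) - 1)) ^ 2 +
      (P t + b / a * r * Real.sin (r * t)) ^ 2) 0 t := by
    refine ((((hY t).pow 2).const_mul a).add ((hZ t).pow 2)).congr_deriv ?_
    ring
  have hconst := is_const_of_deriv_eq_zero (fun t => (hE t).differentiableAt)
    (fun t => (hE t).deriv) t 0
  simp only [hX0, hP0, mul_zero, Real.cos_zero, Real.sin_zero, sub_self, add_zero] at hconst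
  have hsq : (X t - b / a * (Real.cos (r * t) - 1)) ^ 2 = 0 := by
    have h1 := sq_nonneg (P t + b / a * r * Real.sin (r * t))
    have h2 := sq_nonneg (X t - b / a * (Real.cos (r * t) - 1))
    nlinarith
  exact sub_eq_zero.1 (pow_eq_zero_iff two_ne_zero |>.1 hsq)

theorem integral_gaussian_density {σ : ℝ} (hσ : 0 < σ) :
    ∫ x : ℝ, ((1 / (2 * Real.pi * σ ^ 2)) ^ ((1 : ℝ) / 4) * Real.exp (-x ^ 2 / (4 * σ ^ 2))) *
      ((1 / (2 * Real.pi * σ ^ 2)) ^ ((1 : ℝ) / 4) * Real.exp (-x ^ 2 / (4 * σ ^ 2))) = 1 := by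
  have hA : (0 : ℝ) < 1 / (2 * Real.pi * σ ^ 2) := by positivity
  have hsq : (1 / (2 * Real.pi * σ ^ 2)) ^ ((1 : ℝ) / 4) *
      (1 / (2 * Real.pi * σ ^ 2)) ^ ((1 : ℝ) / 4) = Real.sqrt (1 / (2 * Real.pi * σ ^ 2)) := by
    rw [← Real.rpow_add hA, Real.sqrt_eq_rpow]
    norm_num
  have hfun (x : ℝ) : ((1 / (2 * Real.pi * σ ^ 2)) ^ ((1 : ℝ) / 4) *
      Real.exp (-x ^ 2 / (4 * σ ^ 2))) * ((1 / (2 * Real.pi * σ ^ 2)) ^ ((1 : ℝ) / 4) *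
      Real.exp (-x ^ 2 / (4 * σ ^ 2))) =
      Real.sqrt (1 / (2 * Real.pi * σ ^ 2)) * Real.exp (-(1 / (2 * σ ^ 2)) * x ^ 2) := by
    rw [mul_mul_mul_comm, hsq, ← Real.exp_add]
    congr 2
    field_simp
    ring
  simp only [hfun]
  rw [integral_const_mul, integral_gaussian, ← Real.sqrt_mul hA.le, Real.sqrt_eq_one]
  field_simp

/-- **Expected position for a driven harmonic oscillator.** Let `Ψ(t,x)` solve the
one-dimensional Schrödinger equation
`i ∂Ψ/∂t = -(1/2) ∂²Ψ/∂x² + ((1/2) a x² + b x) Ψ` with Gaussian initial state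
`Ψ(0,x) = (1/(2πσ²))^{1/4} exp(-x²/(4σ²))`, where `a > 0` and `σ > 0`. Assume `Ψ` is
continuously differentiable in `t`, and that for each `t` the map `x ↦ Ψ(t,x)` is smooth
and, together with its `x`-derivatives up to second order, decays faster than any inverse
polynomial in `x`, locally uniformly in `t`. Then for every `t ≥ 0`,
`∫ x |Ψ(t,x)|² dx = (b/a)(cos(√a t) - 1)`. -/
theorem driven_oscillator_expected_position (a b σ : ℝ) (ha : 0 < a) (hσ : 0 < σ)
    (Ψ : ℝ → ℝ → ℂ)
    (hPDE : ∀ t x : ℝ,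
      Complex.I * deriv (fun τ : ℝ => Ψ τ x) t =
        -(1 / 2) * iteratedDeriv 2 (fun y : ℝ => Ψ t y) x +
          (((1 / 2 : ℝ) * a * x ^ 2 + b * x : ℝ) : ℂ) * Ψ t x)
    (hInit : ∀ x : ℝ,
      Ψ 0 x = (((1 / (2 * Real.pi * σ ^ 2)) ^ ((1 : ℝ) / 4) : ℝ) : ℂ) *
        Complex.exp (-(x : ℂ) ^ 2 / (4 * (σ : ℂ) ^ 2)))
    (hCt : ∀ x : ℝ, ContDiff ℝ 1 fun t : ℝ => Ψ t x)
    (hCx : ∀ t : ℝ, ContDiff ℝ (⊤ : ℕ∞) fun x : ℝ => Ψ t x)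
    (hdecay : ∀ k : ℕ, ∀ j : ℕ, j ≤ 2 → ∀ T : ℝ, 0 < T → ∃ C : ℝ,
      ∀ t x : ℝ, |t| ≤ T → ‖iteratedDeriv j (fun y : ℝ => Ψ t y) x‖ * |x| ^ k ≤ C)
    (t : ℝ) (ht : 0 ≤ t) :
    ∫ x : ℝ, x * ‖Ψ t x‖ ^ 2 = b / a * (Real.cos (Real.sqrt a * t) - 1) := by
  have hd1 : ∀ t x : ℝ, HasDerivAt (fun y => Ψ t y) (iteratedDeriv 1 (fun y => Ψ t y) x) x := by
    intro t x
    rw [iteratedDeriv_one]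
    exact ((hCx t).differentiable (by simp)).differentiableAt.hasDerivAt
  have hd2 : ∀ t x : ℝ, HasDerivAt (iteratedDeriv 1 (fun y => Ψ t y))
      (iteratedDeriv 2 (fun y => Ψ t y) x) x := by
    intro t x
    rw [iteratedDeriv_succ (n := 1)]
    exact ((hCx t).differentiable_iteratedDeriv 1
      (by exact_mod_cast WithTop.coe_lt_top 1)).differentiableAt.hasDerivAt
  have hcont : ∀ j t, Continuous (iteratedDeriv j (fun y : ℝ => Ψ t y)) := fun j t =>
    (hCx t).continuous_iteratedDeriv j (by exact_mod_cast le_top)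
  have hre : ∀ j, j ≤ 2 → RapidDecay fun t x => (iteratedDeriv j (fun y => Ψ t y) x).re := by
    refine fun j hj => ⟨fun t => Complex.continuous_re.comp (hcont j t), fun k T hT => ?_⟩
    obtain ⟨C, hC⟩ := hdecay k j hj T hT
    exact ⟨C, fun t x ht => le_trans (by gcongr; exact Complex.abs_re_le_norm _) (hC t x ht)⟩
  have him : ∀ j, j ≤ 2 → RapidDecay fun t x => (iteratedDeriv j (fun y => Ψ t y) x).im := by
    refine fun j hj => ⟨fun t => Complex.continuous_im.comp (hcont j t), fun k T hT => ?_⟩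
    obtain ⟨C, hC⟩ := hdecay k j hj T hT
    exact ⟨C, fun t x ht => le_trans (by gcongr; exact Complex.abs_im_le_norm _) (hC t x ht)⟩
  have hdt : ∀ t x : ℝ, HasDerivAt (fun τ => Ψ τ x) (deriv (fun τ => Ψ τ x) t) t := fun t x =>
    ((hCt x).differentiable (by simp)).differentiableAt.hasDerivAt
  have hsol : IsOscillatorSolution a b (fun t x => (Ψ t x).re) (fun t x => (Ψ t x).im)
      (fun t x => (iteratedDeriv 1 (fun y => Ψ t y) x).re)
      (fun t x => (iteratedDeriv 1 (fun y => Ψ t y) x).im)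
      (fun t x => (iteratedDeriv 2 (fun y => Ψ t y) x).re)
      (fun t x => (iteratedDeriv 2 (fun y => Ψ t y) x).im) :=
    { decay_re := by simpa using hre 0 (by norm_num)
      decay_im := by simpa using him 0 (by norm_num)
      decay_re₁ := hre 1 (by norm_num)
      decay_im₁ := him 1 (by norm_num)
      decay_re₂ := hre 2 le_rfl
      decay_im₂ := him 2 le_rfl
      deriv_re := fun t x => Complex.reCLM.hasFDerivAt.comp_hasDerivAt x (hd1 t x)
      deriv_im := fun t x => Complex.imCLM.hasFDerivAt.comp_hasDerivAt x (hd1 t x)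
      deriv_re₁ := fun t x => Complex.reCLM.hasFDerivAt.comp_hasDerivAt x (hd2 t x)
      deriv_im₁ := fun t x => Complex.imCLM.hasFDerivAt.comp_hasDerivAt x (hd2 t x)
      deriv_time_re := fun t x => by
        refine (Complex.reCLM.hasFDerivAt.comp_hasDerivAt t (hdt t x)).congr_deriv ?_
        have := congrArg Complex.im (hPDE t x)
        rw [Complex.add_im, Complex.im_ofReal_mul,
          show (-(1 / 2) : ℂ) = ((-(1 / 2) : ℝ) : ℂ) by push_cast; rfl, Complex.im_ofReal_mul,
          Complex.I_mul_im] at this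
        simp only [Complex.reCLM_apply]
        linear_combination this
      deriv_time_im := fun t x => by
        refine (Complex.imCLM.hasFDerivAt.comp_hasDerivAt t (hdt t x)).congr_deriv ?_
        have := congrArg Complex.re (hPDE t x)
        rw [Complex.add_re, Complex.re_ofReal_mul,
          show (-(1 / 2) : ℂ) = ((-(1 / 2) : ℝ) : ℂ) by push_cast; rfl, Complex.re_ofReal_mul,
          Complex.I_mul_re] at this
        simp only [Complex.imCLM_apply]
        linear_combination -this }
  set g : ℝ → ℝ := fun x =>
    (1 / (2 * Real.pi * σ ^ 2)) ^ ((1 : ℝ) / 4) * Real.exp (-x ^ 2 / (4 * σ ^ 2)) with hg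
  have hΨ0 : ∀ x, Ψ 0 x = (g x : ℂ) := by
    intro x
    rw [hInit x, hg]
    push_cast
    rfl
  have hgim : ∀ x, (iteratedDeriv 1 (fun y => Ψ 0 y) x).im = 0 := by
    intro x
    refine (hsol.deriv_im 0 x).unique ?_
    simpa only [hΨ0, Complex.ofReal_im] using hasDerivAt_const x (0 : ℝ)
  have hmass : ∀ t, ∫ x, (Ψ t x).re * (Ψ t x).re + (Ψ t x).im * (Ψ t x).im = 1 := by
    intro t
    rw [is_const_of_deriv_eq_zero (fun t => (hsol.hasDerivAt_mass t).differentiableAt)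
      (fun t => (hsol.hasDerivAt_mass t).deriv) t 0]
    simp only [hΨ0, Complex.ofReal_re, Complex.ofReal_im, mul_zero, add_zero]
    exact integral_gaussian_density hσ
  have hX0 : ∫ x, x * ((Ψ 0 x).re * (Ψ 0 x).re + (Ψ 0 x).im * (Ψ 0 x).im) = 0 := by
    simp only [hΨ0, Complex.ofReal_re, Complex.ofReal_im, mul_zero, add_zero]
    have hodd := integral_neg_eq_self (fun x : ℝ => x * (g x * g x)) volume
    have hneg : ∀ x, g (-x) = g x := fun x => by simp only [hg, neg_sq]
    simp only [hneg, neg_mul, integral_neg] at hodd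
    linarith
  have hnorm : ∀ x, ‖Ψ t x‖ ^ 2 = (Ψ t x).re * (Ψ t x).re + (Ψ t x).im * (Ψ t x).im := fun x => by
    rw [Complex.sq_norm, Complex.normSq_apply]
  simp only [hnorm]
  refine driven_oscillator_ode ha hsol.hasDerivAt_position (fun t => ?_) hX0 ?_ t
  · simpa only [hmass, mul_one] using hsol.hasDerivAt_momentum t
  · simp only [hgim]
    simp [hΨ0]
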